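/- arXiv:1602.06078 — 7 statements merged into one kernel-verified Lean document; each statement's English description precedes it below -/
import Mathlib

section
/- Let J and Y be as in the context (a Bessel pair of order ν). Then for all z > 0 one has Y'(z)·J''''(z) − J'(z)·Y''''(z) = (2/(π·z))·(1 − (3 + 2ν²)/z² + (ν⁴ + 11ν²)/z⁴), where '''' denotes the fourth derivative. -/
/-- Differentiating `g = a f' + b f` on the positive half-line, for a solution `f` of Bessel's
equation, again gives a combination of `f'` and `f`. -/
theorem deriv_combination_of_bessel {ν : ℝ} {f g a b : ℝ → ℝ}
    (hf : ContDiffOn ℝ (⊤ : ℕ∞) f (Set.Ioi 0))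
    (hode : ∀ z > (0 : ℝ),
      z ^ 2 * iteratedDeriv 2 f z + z * deriv f z + (z ^ 2 - ν ^ 2) * f z = 0)
    (hg : ∀ z > (0 : ℝ), g z = a z * deriv f z + b z * f z)
    {z a' b' : ℝ} (hz : 0 < z) (ha : HasDerivAt a a' z) (hb : HasDerivAt b b' z) :
    deriv g z = (a' - a z / z + b z) * deriv f z + (b' + a z * (ν ^ 2 / z ^ 2 - 1)) * f z := by
  have hf₀ : HasDerivAt f (deriv f z) z :=
    ((hf.differentiableOn (by simp)).differentiableAt (Ioi_mem_nhds hz)).hasDerivAt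
  have hf₁ : HasDerivAt (deriv f) (iteratedDeriv 2 f z) z := by
    rw [iteratedDeriv_succ, iteratedDeriv_one]
    have h : ContDiffOn ℝ (⊤ : ℕ∞) (deriv f) (Set.Ioi 0) :=
      hf.deriv_of_isOpen isOpen_Ioi le_rfl
    exact ((h.differentiableOn (by simp)).differentiableAt (Ioi_mem_nhds hz)).hasDerivAt
  have hsecond : iteratedDeriv 2 f z = -deriv f z / z + (ν ^ 2 / z ^ 2 - 1) * f z := by
    field_simp
    linear_combination hode z hz
  have heq : g =ᶠ[nhds z] fun x => a x * deriv f x + b x * f x :=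
    Filter.eventually_of_mem (Ioi_mem_nhds hz) hg
  rw [heq.deriv_eq, ((ha.fun_mul hf₁).fun_add (hb.fun_mul hf₀)).deriv, hsecond]
  ring

/-- The fourth derivative of a solution of Bessel's equation in terms of `f'` and `f`. -/
theorem iteratedDeriv_four_of_bessel {ν : ℝ} {f : ℝ → ℝ}
    (hf : ContDiffOn ℝ (⊤ : ℕ∞) f (Set.Ioi 0))
    (hode : ∀ z > (0 : ℝ),
      z ^ 2 * iteratedDeriv 2 f z + z * deriv f z + (z ^ 2 - ν ^ 2) * f z = 0)
    {z : ℝ} (hz : 0 < z) :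
    iteratedDeriv 4 f z = (2 / z - (6 + 6 * ν ^ 2) / z ^ 3) * deriv f z
      + (1 - (3 + 2 * ν ^ 2) / z ^ 2 + (ν ^ 4 + 11 * ν ^ 2) / z ^ 4) * f z := by
  have hdiv (c : ℝ) (n : ℕ) {x : ℝ} (hx : 0 < x) :
      HasDerivAt (fun y : ℝ => c / y ^ n) (-(c * (n * x ^ (n - 1))) / (x ^ n) ^ 2) x := by
    simpa using (hasDerivAt_const x c).fun_div (hasDerivAt_pow n x) (pow_ne_zero n hx.ne')
  have h₂ : ∀ x > (0 : ℝ), iteratedDeriv 2 f x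
      = -1 / x ^ 1 * deriv f x + (ν ^ 2 / x ^ 2 - 1) * f x := by
    intro x hx
    field_simp
    linear_combination hode x hx
  have h₃ : ∀ x > (0 : ℝ), iteratedDeriv 3 f x
      = ((2 + ν ^ 2) / x ^ 2 - 1) * deriv f x + (1 / x ^ 1 - 3 * ν ^ 2 / x ^ 3) * f x := by
    intro x hx
    rw [iteratedDeriv_succ, deriv_combination_of_bessel hf hode h₂ hx (hdiv (-1) 1 hx)
      ((hdiv (ν ^ 2) 2 hx).sub_const 1)]
    norm_num
    field_simp
    ring
  rw [iteratedDeriv_succ, deriv_combination_of_bessel hf hode h₃ hz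
    ((hdiv (2 + ν ^ 2) 2 hz).sub_const 1) ((hdiv 1 1 hz).fun_sub (hdiv (3 * ν ^ 2) 3 hz))]
  norm_num
  field_simp
  ring

/-- Cross-product identity
`Y'·J'''' − J'·Y'''' = (2/(π z))·(1 − (3+2ν²)/z² + (ν⁴+11ν²)/z⁴)` for a Bessel pair of order `ν`. -/
theorem cross_product_first_fourth_deriv
    (ν : ℝ) (hν : 0 ≤ ν) (J Y : ℝ → ℝ)
    (hJ : ContDiffOn ℝ (⊤ : ℕ∞) J (Set.Ioi 0)) (hY : ContDiffOn ℝ (⊤ : ℕ∞) Y (Set.Ioi 0))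
    (hJode : ∀ z > (0:ℝ),
      z ^ 2 * iteratedDeriv 2 J z + z * deriv J z + (z ^ 2 - ν ^ 2) * J z = 0)
    (hYode : ∀ z > (0:ℝ),
      z ^ 2 * iteratedDeriv 2 Y z + z * deriv Y z + (z ^ 2 - ν ^ 2) * Y z = 0)
    (hW : ∀ z > (0:ℝ), J z * deriv Y z - Y z * deriv J z = 2 / (Real.pi * z)) :
    ∀ z > (0:ℝ),
      deriv Y z * iteratedDeriv 4 J z - deriv J z * iteratedDeriv 4 Y z
        = 2 / (Real.pi * z) * (1 - (3 + 2 * ν ^ 2) / z ^ 2 + (ν ^ 4 + 11 * ν ^ 2) / z ^ 4) := by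
  intro z hz
  rw [iteratedDeriv_four_of_bessel hJ hJode hz, iteratedDeriv_four_of_bessel hY hYode hz,
    ← hW z hz]
  ring
end

section
/- Let J and Y be as in the context (a Bessel pair of order ν). Then for every integer k ≥ 1 there exist a number r ∈ {−1, 0, 1} and a real polynomial Q with Q(0) = 0 such that for all z > 0 one has Y(z)·J⁽ᵏ⁾(z) − J(z)·Y⁽ᵏ⁾(z) = (2/(π·z))·(r + Q(1/z)), where J⁽ᵏ⁾ and Y⁽ᵏ⁾ denote the k-th derivatives. -/
open Polynomial in
/-- Every iterated derivative of a solution of Bessel's equation on `(0, ∞)` is a combination of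
the solution and its first derivative, with coefficients that are polynomials in `1 / z` depending
only on `ν` and the order of differentiation. -/
theorem iteratedDeriv_bessel_eq (ν : ℝ) (k : ℕ) :
    ∃ A B : ℝ[X],
      ((A.eval 0 = 0 ∧ (B.eval 0 = 1 ∨ B.eval 0 = -1)) ∨
        (B.eval 0 = 0 ∧ (A.eval 0 = 1 ∨ A.eval 0 = -1))) ∧
      ∀ f : ℝ → ℝ, ContDiffOn ℝ 2 f (Set.Ioi 0) →
        (∀ z > (0 : ℝ),
          z ^ 2 * iteratedDeriv 2 f z + z * deriv f z + (z ^ 2 - ν ^ 2) * f z = 0) →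
        ∀ z > (0 : ℝ),
          iteratedDeriv k f z = A.eval z⁻¹ * f z + B.eval z⁻¹ * deriv f z := by
  induction k with
  | zero => exact ⟨1, 0, by simp, by simp⟩
  | succ k ih =>
    obtain ⟨A, B, h0, h⟩ := ih
    refine ⟨-X ^ 2 * derivative A + (C (ν ^ 2) * X ^ 2 - 1) * B,
      A - X ^ 2 * derivative B - X * B, ?_, fun f hf hode z hz => ?_⟩
    · simp only [eval_add, eval_sub, eval_mul, eval_neg, eval_pow, eval_X, eval_C, eval_one]
      grind
    · have hfz : HasDerivAt f (deriv f z) z :=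
        ((hf.differentiableOn (by norm_num)).differentiableAt (Ioi_mem_nhds hz)).hasDerivAt
      have hf'z : HasDerivAt (deriv f) (iteratedDeriv 2 f z) z := by
        have hd : ContDiffOn ℝ 1 (deriv f) (Set.Ioi 0) :=
          hf.deriv_of_isOpen isOpen_Ioi (by norm_num)
        rw [iteratedDeriv_succ, iteratedDeriv_one]
        exact ((hd.differentiableOn (by norm_num)).differentiableAt (Ioi_mem_nhds hz)).hasDerivAt
      have hpoly (P : ℝ[X]) := (P.hasDerivAt z⁻¹).comp z (hasDerivAt_inv hz.ne')
      have hev : iteratedDeriv k f =ᶠ[nhds z]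
          fun w => A.eval w⁻¹ * f w + B.eval w⁻¹ * deriv f w := by
        filter_upwards [Ioi_mem_nhds hz] with w hw using h f hf hode w hw
      have h2 : iteratedDeriv 2 f z = -z⁻¹ * deriv f z + (ν ^ 2 * z⁻¹ ^ 2 - 1) * f z := by
        have := hode z hz
        field_simp
        linarith
      rw [iteratedDeriv_succ, hev.deriv_eq]
      refine (((hpoly A).mul hfz).add ((hpoly B).mul hf'z)).deriv.trans ?_
      rw [h2]
      simp only [eval_add, eval_sub, eval_mul, eval_neg, eval_pow, eval_X, eval_C, eval_one,
        Function.comp_apply]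
      ring

/-- For every `k ≥ 1`, the cross product `Y·J⁽ᵏ⁾ − J·Y⁽ᵏ⁾` of a Bessel pair of order `ν`
equals `(2/(π z))·(r + Q(1/z))` for some `r ∈ {−1,0,1}` and a polynomial `Q` with `Q(0) = 0`. -/
theorem cross_product_higher_deriv
    (ν : ℝ) (hν : 0 ≤ ν) (J Y : ℝ → ℝ)
    (hJ : ContDiffOn ℝ (⊤ : ℕ∞) J (Set.Ioi 0)) (hY : ContDiffOn ℝ (⊤ : ℕ∞) Y (Set.Ioi 0))
    (hJode : ∀ z > (0:ℝ),
      z ^ 2 * iteratedDeriv 2 J z + z * deriv J z + (z ^ 2 - ν ^ 2) * J z = 0)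
    (hYode : ∀ z > (0:ℝ),
      z ^ 2 * iteratedDeriv 2 Y z + z * deriv Y z + (z ^ 2 - ν ^ 2) * Y z = 0)
    (hW : ∀ z > (0:ℝ), J z * deriv Y z - Y z * deriv J z = 2 / (Real.pi * z)) :
    ∀ k : ℕ, 1 ≤ k →
      ∃ r : ℝ, (r = -1 ∨ r = 0 ∨ r = 1) ∧
        ∃ Q : Polynomial ℝ, Q.eval 0 = 0 ∧
          ∀ z > (0:ℝ),
            Y z * iteratedDeriv k J z - J z * iteratedDeriv k Y z
              = 2 / (Real.pi * z) * (r + Q.eval (1 / z)) := by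
  intro k _
  obtain ⟨A, B, h0, h⟩ := iteratedDeriv_bessel_eq ν k
  refine ⟨-B.eval 0, by grind, Polynomial.C (B.eval 0) - B, by simp, fun z hz => ?_⟩
  have h2le : (2 : WithTop ℕ∞) ≤ ((⊤ : ℕ∞) : WithTop ℕ∞) :=
    WithTop.coe_le_coe.2 (le_top : (2 : ℕ∞) ≤ ⊤)
  rw [h J (hJ.of_le h2le) hJode z hz,
    h Y (hY.of_le h2le) hYode z hz, ← hW z hz]
  simp only [Polynomial.eval_sub, Polynomial.eval_C, one_div]
  ring
end

section
/- Let J and Y be as in the context (a Bessel pair of order ν). Then for every integer k ≥ 1 there exist a number q ∈ {−1, 0, 1} and a real polynomial Q with Q(0) = 0 such that for all z > 0 one has Y'(z)·J⁽ᵏ⁾(z) − J'(z)·Y⁽ᵏ⁾(z) = (2/(π·z))·(q + Q(1/z)), where J⁽ᵏ⁾ and Y⁽ᵏ⁾ denote the k-th derivatives. -/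
open Polynomial in
/-- The derivatives of the solutions of Bessel's equation of order `ν` are combinations of the
solution and its first derivative, with coefficients polynomial in `1 / z` that do not depend on
the solution and whose values at `0` are those of the derivatives of a sinusoid. -/
theorem exists_iteratedDeriv_bessel_eq (ν : ℝ) (k : ℕ) :
    ∃ A B : ℝ[X],
      (((A.eval 0 = 1 ∨ A.eval 0 = -1) ∧ B.eval 0 = 0) ∨
        (A.eval 0 = 0 ∧ (B.eval 0 = 1 ∨ B.eval 0 = -1))) ∧
      ∀ f : ℝ → ℝ, ContDiffOn ℝ 2 f (Set.Ioi 0) →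
        (∀ z > (0 : ℝ), z ^ 2 * iteratedDeriv 2 f z + z * deriv f z + (z ^ 2 - ν ^ 2) * f z = 0) →
        ∀ z > (0 : ℝ), iteratedDeriv k f z = A.eval z⁻¹ * f z + B.eval z⁻¹ * deriv f z := by
  induction k with
  | zero => exact ⟨1, 0, by simp, by simp⟩
  | succ k ih =>
    obtain ⟨A, B, h0, h⟩ := ih
    refine ⟨-X ^ 2 * derivative A + B * (C (ν ^ 2) * X ^ 2 - 1),
      A - X ^ 2 * derivative B - X * B, ?_, fun f hf hode z hz => ?_⟩
    · simp only [eval_add, eval_sub, eval_mul, eval_neg, eval_pow, eval_X, eval_C, eval_one]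
      grind
    have hf1 : HasDerivAt f (deriv f z) z :=
      ((hf.contDiffAt (Ioi_mem_nhds hz)).differentiableAt (by norm_num)).hasDerivAt
    have hf2 : HasDerivAt (deriv f) (iteratedDeriv 2 f z) z := by
      have hd : ContDiffOn ℝ 1 (deriv f) (Set.Ioi 0) :=
        hf.deriv_of_isOpen isOpen_Ioi (by norm_num)
      rw [iteratedDeriv_succ, iteratedDeriv_one]
      exact ((hd.contDiffAt (Ioi_mem_nhds hz)).differentiableAt (by norm_num)).hasDerivAt
    have hinv := hasDerivAt_inv hz.ne'
    have hA := (A.hasDerivAt z⁻¹).comp z hinv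
    have hB := (B.hasDerivAt z⁻¹).comp z hinv
    have hev : iteratedDeriv k f =ᶠ[nhds z]
        fun w => A.eval w⁻¹ * f w + B.eval w⁻¹ * deriv f w := by
      filter_upwards [Ioi_mem_nhds hz] with w hw using h f hf hode w hw
    have hd : HasDerivAt (fun w => A.eval w⁻¹ * f w + B.eval w⁻¹ * deriv f w) _ z :=
      (hA.mul hf1).add (hB.mul hf2)
    have hf'' : iteratedDeriv 2 f z = (ν ^ 2 * z⁻¹ ^ 2 - 1) * f z - z⁻¹ * deriv f z := by
      have hz' := hz.ne'
      field_simp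
      linear_combination hode z hz
    rw [iteratedDeriv_succ, hev.deriv_eq, hd.deriv, hf'']
    simp only [Function.comp_apply, eval_add, eval_sub, eval_mul, eval_neg, eval_pow, eval_X,
      eval_C, eval_one]
    ring


/-- For every `k ≥ 1`, the cross product `Y'·J⁽ᵏ⁾ − J'·Y⁽ᵏ⁾` of a Bessel pair of order `ν`
equals `(2/(π z))·(q + Q(1/z))` for some `q ∈ {−1,0,1}` and a polynomial `Q` with `Q(0) = 0`. -/
theorem cross_product_deriv_higher_deriv
    (ν : ℝ) (hν : 0 ≤ ν) (J Y : ℝ → ℝ)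
    (hJ : ContDiffOn ℝ (⊤ : ℕ∞) J (Set.Ioi 0)) (hY : ContDiffOn ℝ (⊤ : ℕ∞) Y (Set.Ioi 0))
    (hJode : ∀ z > (0:ℝ),
      z ^ 2 * iteratedDeriv 2 J z + z * deriv J z + (z ^ 2 - ν ^ 2) * J z = 0)
    (hYode : ∀ z > (0:ℝ),
      z ^ 2 * iteratedDeriv 2 Y z + z * deriv Y z + (z ^ 2 - ν ^ 2) * Y z = 0)
    (hW : ∀ z > (0:ℝ), J z * deriv Y z - Y z * deriv J z = 2 / (Real.pi * z)) :
    ∀ k : ℕ, 1 ≤ k →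
      ∃ q : ℝ, (q = -1 ∨ q = 0 ∨ q = 1) ∧
        ∃ Q : Polynomial ℝ, Q.eval 0 = 0 ∧
          ∀ z > (0:ℝ),
            deriv Y z * iteratedDeriv k J z - deriv J z * iteratedDeriv k Y z
              = 2 / (Real.pi * z) * (q + Q.eval (1 / z)) := by
  intro k _
  obtain ⟨A, B, h0, h⟩ := exists_iteratedDeriv_bessel_eq ν k
  refine ⟨A.eval 0, by grind, A - Polynomial.C (A.eval 0), by simp, fun z hz => ?_⟩
  have h2 : (2 : WithTop ℕ∞) ≤ ((⊤ : ℕ∞) : WithTop ℕ∞) :=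
    WithTop.coe_le_coe.2 (le_top (a := (2 : ℕ∞)))
  rw [h J (hJ.of_le h2) hJode z hz, h Y (hY.of_le h2) hYode z hz, ← hW z hz, one_div,
    Polynomial.eval_sub, Polynomial.eval_C]
  ring
end

section
/- Fix M > 0 and ε ∈ (0,1) with ρ₂ := M/(2ε) − 1 + ε > 0, and let λ > 0 be an eigenvalue of the Neumann problem (Neu1) with parameter ε as defined in the context. Then λ satisfies the transcendental equation 2·√(ε·ρ₂)·cos(2·√(λ·ε)·(1−ε))·sin(2·ε·√(λ·ρ₂)) + [−M/(2ε) + 1 + (M/(2ε) − 1 + 2ε)·cos(2·ε·√(λ·ρ₂))]·sin(2·√(λ·ε)·(1−ε)) = 0. -/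
/-- The mass density `ρ_ε` on `(−1,1)`: equal to `ε` on the middle interval
`(−1+ε, 1−ε)` and to `M/(2ε) − 1 + ε` in the boundary layers. -/
noncomputable def rho1D (M ε x : ℝ) : ℝ :=
  if -1 + ε < x ∧ x < 1 - ε then ε else M / (2 * ε) - 1 + ε

/-- `lam` is an eigenvalue of the one-dimensional Neumann problem `−u'' = lam ρ_ε u` on
`(−1,1)` with `u'(±1) = 0`: there is a not identically zero function `u`, continuously
differentiable on `[−1,1]`, twice differentiable on each of the three open subintervals
determined by the interface points `−1+ε` and `1−ε`, where it satisfies the equation. -/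
def IsNeumannEV1D (M ε lam : ℝ) : Prop :=
  ∃ u : ℝ → ℝ,
    (∃ x ∈ Set.Icc (-1 : ℝ) 1, u x ≠ 0) ∧
    (∀ x ∈ Set.Icc (-1 : ℝ) 1, DifferentiableAt ℝ u x) ∧
    ContinuousOn (deriv u) (Set.Icc (-1) 1) ∧
    (∀ x ∈ Set.Ioo (-1 : ℝ) 1, x ≠ -1 + ε → x ≠ 1 - ε →
      DifferentiableAt ℝ (deriv u) x ∧
      -(deriv (deriv u) x) = lam * rho1D M ε x * u x) ∧
    deriv u (-1) = 0 ∧ deriv u 1 = 0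

/-- A function continuous on `[a, b]` whose derivative vanishes on `(a, b)` takes the same value
at both endpoints. -/
lemma eq_endpoints_of_hasDerivAt_zero {f : ℝ → ℝ} {a b : ℝ} (hab : a ≤ b)
    (hf : ContinuousOn f (Set.Icc a b)) (hf' : ∀ x ∈ Set.Ioo a b, HasDerivAt f 0 x) :
    f b = f a := by
  rcases hab.eq_or_lt with rfl | hlt
  · rfl
  · obtain ⟨c, -, hc⟩ := exists_hasDerivAt_eq_slope f (fun _ => 0) hlt hf hf'
    have hne : b - a ≠ 0 := (sub_pos.2 hlt).ne'
    field_simp at hc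
    linarith

/-- The solution of the first-order system `u' = v`, `v' = -k² u` at `b` in terms of its Cauchy
data at `a`. -/
lemma harmonic_propagation {u v : ℝ → ℝ} {a b k : ℝ} (hk : k ≠ 0) (hab : a ≤ b)
    (huc : ContinuousOn u (Set.Icc a b)) (hvc : ContinuousOn v (Set.Icc a b))
    (hu : ∀ x ∈ Set.Ioo a b, HasDerivAt u (v x) x)
    (hv : ∀ x ∈ Set.Ioo a b, HasDerivAt v (-(k ^ 2 * u x)) x) :
    u b = u a * Real.cos (k * (b - a)) + v a / k * Real.sin (k * (b - a)) ∧
      v b = -(k * u a * Real.sin (k * (b - a))) + v a * Real.cos (k * (b - a)) := by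
  have harg (x : ℝ) : HasDerivAt (fun y => k * (b - y)) (-k) x := by
    simpa using ((hasDerivAt_id x).const_sub b).const_mul k
  constructor
  · have h := eq_endpoints_of_hasDerivAt_zero
      (f := fun x => u x * Real.cos (k * (b - x)) + v x / k * Real.sin (k * (b - x))) hab
      (by fun_prop (disch := assumption)) (fun x hx => by
        refine (((hu x hx).mul (harg x).cos).add
          (((hv x hx).div_const k).mul (harg x).sin)).congr_deriv ?_
        field_simp
        ring)
    simpa using h
  · have h := eq_endpoints_of_hasDerivAt_zero
      (f := fun x => -(k * u x * Real.sin (k * (b - x))) + v x * Real.cos (k * (b - x))) hab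
      (by fun_prop) (fun x hx => by
        refine (((((hu x hx).const_mul k).mul (harg x).sin).neg).add
          ((hv x hx).mul (harg x).cos)).congr_deriv ?_
        ring)
    simpa using h

/-- A positive eigenvalue `lam` of the one-dimensional Neumann problem with parameter `ε`
satisfies the transcendental equation obtained from the matching conditions. -/
theorem neumann_1d_transcendental_equation
    (M ε lam ρ₂ : ℝ) (hM : 0 < M) (hε : ε ∈ Set.Ioo (0:ℝ) 1)
    (hρ₂ : ρ₂ = M / (2 * ε) - 1 + ε) (hρ₂pos : 0 < ρ₂)
    (hlam : 0 < lam) (hEV : IsNeumannEV1D M ε lam) :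
    2 * Real.sqrt (ε * ρ₂) * Real.cos (2 * Real.sqrt (lam * ε) * (1 - ε))
        * Real.sin (2 * ε * Real.sqrt (lam * ρ₂))
      + (-(M / (2 * ε)) + 1
          + (M / (2 * ε) - 1 + 2 * ε) * Real.cos (2 * ε * Real.sqrt (lam * ρ₂)))
        * Real.sin (2 * Real.sqrt (lam * ε) * (1 - ε)) = 0 := by
  obtain ⟨hε0, hε1⟩ := hε
  obtain ⟨u, ⟨z, hz, hzne⟩, hud, hvc, hode, hv0, hv1⟩ := hEV
  set p := Real.sqrt (lam * ε) with hp
  set q := Real.sqrt (lam * ρ₂) with hq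
  have hp0 : 0 < p := Real.sqrt_pos.2 (mul_pos hlam hε0)
  have hq0 : 0 < q := Real.sqrt_pos.2 (mul_pos hlam hρ₂pos)
  have hp2 : p ^ 2 = lam * ε := Real.sq_sqrt (mul_pos hlam hε0).le
  have hq2 : q ^ 2 = lam * ρ₂ := Real.sq_sqrt (mul_pos hlam hρ₂pos).le
  have hpq : p * q = lam * Real.sqrt (ε * ρ₂) := by
    rw [hp, hq, ← Real.sqrt_mul (mul_pos hlam hε0).le,
      show lam * ε * (lam * ρ₂) = lam ^ 2 * (ε * ρ₂) by ring,
      Real.sqrt_mul (sq_nonneg lam), Real.sqrt_sq hlam.le]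
  have hprop {a b k : ℝ} (hk : 0 < k) (hab : a ≤ b) (ha : -1 ≤ a) (hb : b ≤ 1)
      (hx : ∀ x ∈ Set.Ioo a b, x ≠ -1 + ε ∧ x ≠ 1 - ε ∧ lam * rho1D M ε x = k ^ 2) :=
    harmonic_propagation (u := u) (v := deriv u) hk.ne' hab
      (fun x h => (hud x ⟨ha.trans h.1, h.2.trans hb⟩).continuousAt.continuousWithinAt)
      (hvc.mono (Set.Icc_subset_Icc ha hb))
      (fun x h => (hud x ⟨ha.trans h.1.le, h.2.le.trans hb⟩).hasDerivAt)
      (fun x h => by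
        obtain ⟨h1, h2, h3⟩ := hx x h
        obtain ⟨hd, he⟩ := hode x ⟨ha.trans_lt h.1, h.2.trans_le hb⟩ h1 h2
        rw [← h3, ← he, neg_neg]
        exact hd.hasDerivAt)
  have hleft {x : ℝ} (hx1 : -1 ≤ x) (hx2 : x ≤ -1 + ε) :=
    hprop hq0 hx1 le_rfl (by linarith) (fun y hy => by
      have hlt : y < -1 + ε := hy.2.trans_le hx2
      refine ⟨hlt.ne, by linarith, ?_⟩
      rw [rho1D, if_neg (fun h => absurd h.1 hlt.not_gt), hq2, hρ₂])
  have hmid {x : ℝ} (hx1 : -1 + ε ≤ x) (hx2 : x ≤ 1 - ε) :=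
    hprop hp0 hx1 (by linarith) (by linarith) (fun y hy => by
      have hlt : y < 1 - ε := hy.2.trans_le hx2
      refine ⟨hy.1.ne', hlt.ne, ?_⟩
      rw [rho1D, if_pos ⟨hy.1, hlt⟩, hp2])
  have hright {x : ℝ} (hx1 : 1 - ε ≤ x) (hx2 : x ≤ 1) :=
    hprop hq0 hx1 (by linarith) hx2 (fun y hy => by
      refine ⟨by linarith [hy.1], hy.1.ne', ?_⟩
      rw [rho1D, if_neg (fun h => absurd h.2 hy.1.not_gt), hq2, hρ₂])
  have hu0 : u (-1) ≠ 0 := by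
    intro h0
    have hL {x : ℝ} (h1 : -1 ≤ x) (h2 : x ≤ -1 + ε) : u x = 0 ∧ deriv u x = 0 := by
      simpa [h0, hv0] using hleft h1 h2
    obtain ⟨hu1, hv1'⟩ := hL (x := -1 + ε) (by linarith) le_rfl
    have hC {x : ℝ} (h1 : -1 + ε ≤ x) (h2 : x ≤ 1 - ε) : u x = 0 ∧ deriv u x = 0 := by
      simpa [hu1, hv1'] using hmid h1 h2
    obtain ⟨hu2, hv2⟩ := hC (x := 1 - ε) (by linarith) le_rfl
    rcases le_total z (-1 + ε) with h1 | h1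
    · exact hzne (hL hz.1 h1).1
    · rcases le_total z (1 - ε) with h2 | h2
      · exact hzne (hC h1 h2).1
      · exact hzne (by simpa [hu2, hv2] using (hright h2 hz.2).1)
  obtain ⟨hu1, hv1'⟩ := hleft (x := -1 + ε) (by linarith) le_rfl
  obtain ⟨hu2, hv2⟩ := hmid (x := 1 - ε) (by linarith) le_rfl
  obtain ⟨-, hv3⟩ := hright (x := 1) (by linarith) le_rfl
  rw [show -1 + ε - -1 = ε by ring, hv0] at hu1 hv1'
  rw [show 1 - ε - (-1 + ε) = 2 * (1 - ε) by ring] at hu2 hv2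
  rw [show 1 - (1 - ε) = ε by ring, hv1, hu2, hv2, hu1, hv1'] at hv3
  rw [show 2 * p * (1 - ε) = p * (2 * (1 - ε)) by ring,
    show 2 * ε * q = 2 * (q * ε) by ring, Real.sin_two_mul, Real.cos_two_mul,
    show M / (2 * ε) = ρ₂ + 1 - ε by rw [hρ₂]; ring]
  have htrig := Real.sin_sq_add_cos_sq (q * ε)
  generalize Real.sin (q * ε) = s at *
  generalize Real.cos (q * ε) = c at *
  generalize Real.sin (p * (2 * (1 - ε))) = S at *
  generalize Real.cos (p * (2 * (1 - ε))) = C at *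
  have hmatch : 2 * (p * q) * s * c * C - q ^ 2 * s ^ 2 * S + p ^ 2 * c ^ 2 * S = 0 := by
    refine (mul_eq_zero.1 ?_).resolve_left hu0
    have hinv : p * p⁻¹ = 1 := mul_inv_cancel₀ hp0.ne'
    linear_combination p * hv3 + u (-1) * q ^ 2 * s ^ 2 * S * hinv
  rw [hpq, hp2, hq2] at hmatch
  refine (mul_eq_zero.1 ?_).resolve_left hlam.ne'
  linear_combination 2 * hmatch + 2 * lam * ρ₂ * S * htrig
end

section
/- Fix M > 0 and λ > 0. For ε ∈ (0,1) with ρ₂ := M/(2ε) − 1 + ε > 0, define G(ε) := 2·√(ε·ρ₂)·cos(2·√(λ·ε)·(1−ε))·sin(2·ε·√(λ·ρ₂)) + [−M/(2ε) + 1 + (M/(2ε) − 1 + 2ε)·cos(2·ε·√(λ·ρ₂))]·sin(2·√(λ·ε)·(1−ε)). Then (1/(2·√(λ·ε)))·G(ε) = M − λ·M²/2 + (λ·M²/6)·(1 + λ·(2 + M/2))·ε + O(ε²) as ε → 0⁺; that is, there exist C > 0 and δ > 0 such that |(1/(2·√(λ·ε)))·G(ε) − M + λ·M²/2 − (λ·M²/6)·(1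 + λ·(2 + M/2))·ε| ≤ C·ε² for all ε ∈ (0, δ). -/
/-- A real number dominated in absolute value by `t` is a multiple of `t` by a factor
in `[-1, 1]`. -/
theorem exists_mem_Icc_eq_mul_of_abs_le_abs {y t : ℝ} (h : |y| ≤ |t|) :
    ∃ p ∈ Set.Icc (-1 : ℝ) 1, y = p * t := by
  rcases eq_or_ne t 0 with rfl | ht
  · exact ⟨0, by simp, by simpa using h⟩
  · refine ⟨y / t, ?_, by field_simp⟩
    rw [Set.mem_Icc, ← abs_le, abs_div]
    exact div_le_one_of_le₀ h (abs_nonneg t)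

/-- Taylor bound for the complex cosine at degree four. -/
theorem Complex.norm_cos_sub_quartic_le {x : ℂ} (hx : ‖x‖ ≤ 1) :
    ‖Complex.cos x - (1 - x ^ 2 / 2 + x ^ 4 / 24)‖ ≤ ‖x‖ ^ 6 :=
  calc
    ‖Complex.cos x - (1 - x ^ 2 / 2 + x ^ 4 / 24)‖ =
        ‖(Complex.exp (-x * I) - ∑ m ∈ Finset.range 6, (-x * I) ^ m / m.factorial) / 2 +
         (Complex.exp (x * I) - ∑ m ∈ Finset.range 6, (x * I) ^ m / m.factorial) / 2‖ := by
      simp [Complex.cos, field, Finset.sum_range_succ, Nat.factorial]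
      grind [Complex.I_sq, two_ne_zero]
    _ ≤ ‖Complex.exp (-x * I) - ∑ m ∈ Finset.range 6, (-x * I) ^ m / m.factorial‖ / 2 +
        ‖Complex.exp (x * I) - ∑ m ∈ Finset.range 6, (x * I) ^ m / m.factorial‖ / 2 := by
      grw [norm_add_le]
      simp
    _ ≤ ‖-x * I‖ ^ 6 * (Nat.succ 6 * (Nat.factorial 6 * (6 : ℕ) : ℝ)⁻¹) / 2 +
        ‖x * I‖ ^ 6 * (Nat.succ 6 * (Nat.factorial 6 * (6 : ℕ) : ℝ)⁻¹) / 2 := by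
      grw [Complex.exp_bound (by simpa) (by simp), Complex.exp_bound (by simpa) (by simp)]
    _ = ‖x‖ ^ 6 * (7 / 4320) := by
      simp only [norm_mul, norm_neg, Complex.norm_I, mul_one]
      norm_num [Nat.factorial]
    _ ≤ ‖x‖ ^ 6 := mul_le_of_le_one_right (by positivity) (by norm_num)

/-- Degree-four Taylor expansion of the cosine on `[-1, 1]`. -/
theorem Real.exists_cos_eq_quartic_add {x : ℝ} (hx : |x| ≤ 1) :
    ∃ p ∈ Set.Icc (-1 : ℝ) 1, Real.cos x = 1 - x ^ 2 / 2 + x ^ 4 / 24 + p * x ^ 6 := by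
  have hxc : ‖(x : ℂ)‖ ≤ 1 := by simpa using hx
  have h : |Real.cos x - (1 - x ^ 2 / 2 + x ^ 4 / 24)| ≤ |x ^ 6| := by
    rw [abs_pow, ← Real.norm_eq_abs, ← Real.norm_eq_abs x]
    have hbound := Complex.norm_cos_sub_quartic_le hxc
    exact_mod_cast hbound
  obtain ⟨p, hp, hpx⟩ := exists_mem_Icc_eq_mul_of_abs_le_abs h
  exact ⟨p, hp, by linarith⟩

/-- Degree-two Taylor expansion of the cosine on `[-1, 1]`. -/
theorem Real.exists_cos_eq_quadratic_add {x : ℝ} (hx : |x| ≤ 1) :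
    ∃ p ∈ Set.Icc (-1 : ℝ) 1, Real.cos x = 1 - x ^ 2 / 2 + p * x ^ 4 := by
  have h : |Real.cos x - (1 - x ^ 2 / 2)| ≤ |x ^ 4| := by
    rw [abs_pow]
    exact (Real.cos_bound hx).trans (mul_le_of_le_one_right (by positivity) (by norm_num))
  obtain ⟨p, hp, hpx⟩ := exists_mem_Icc_eq_mul_of_abs_le_abs h
  exact ⟨p, hp, by linarith⟩

/-- Degree-three Taylor expansion of the sine on `[-1, 1]`. -/
theorem Real.exists_sin_eq_cubic_add {x : ℝ} (hx : |x| ≤ 1) :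
    ∃ p ∈ Set.Icc (-1 : ℝ) 1, Real.sin x = x * (1 - x ^ 2 / 6 + p * x ^ 4) := by
  have h : |Real.sin x - (x - x ^ 3 / 6)| ≤ |x ^ 5| := by
    rw [abs_pow]
    exact (Real.sin_bound hx).trans (div_le_self (by positivity) (by norm_num))
  obtain ⟨p, hp, hpx⟩ := exists_mem_Icc_eq_mul_of_abs_le_abs h
  exact ⟨p, hp, by linear_combination hpx⟩

/-- The coefficient of `ε ^ 2` in a product of two quadratic polynomials in `ε`, with all higher
powers of `ε` absorbed. -/
noncomputable def quadraticMulRemainder (a₀ a₁ a₂ b₀ b₁ b₂ ε : ℝ) : ℝ :=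
  a₀ * b₂ + a₁ * b₁ + a₂ * b₀ + ε * (a₁ * b₂ + a₂ * b₁) + ε ^ 2 * (a₂ * b₂)

/-- The remainder of the normalized equation after its terms of order `1` and `ε`, divided by
`ε ^ 2`; `p`, `q`, `r`, `s` are the Taylor remainders of the cosine and the sine at the argument
`2ε√(λρ)`, and of the cosine and the sine at the argument `2√(λε)(1 - ε)`. -/
noncomputable def neumannRemainder (M lam ε p q r s : ℝ) : ℝ :=
  quadraticMulRemainder
    1 (-2 * lam) (2 * lam * (2 - ε) + 16 * r * lam ^ 2 * (1 - ε) ^ 4)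
    M (-2 - lam * M ^ 2 / 3)
    (2 - lam * ((-2 + 2 * ε) * (2 * M - 2 * ε + 2 * ε ^ 2)) / 3
      + 4 * q * lam ^ 2 * (M - 2 * ε + 2 * ε ^ 2) ^ 3) ε
  + quadraticMulRemainder
    (-(lam * M ^ 2) / 2) (2 + 2 * lam * M + lam ^ 2 * M ^ 3 / 12)
    (-lam / 2 * (4 + 6 * M - 12 * ε + 8 * ε ^ 2)
      + lam ^ 2 / 12 * ((M - 2 * ε + 4 * ε ^ 2) * ((-2 + 2 * ε) * (2 * M - 2 * ε + 2 * ε ^ 2))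
          + M ^ 2 * (-2 + 4 * ε))
      + 4 * p * lam ^ 3 * (M - 2 * ε + 2 * ε ^ 2) ^ 3 * (M - 2 * ε + 4 * ε ^ 2))
    1 (-(1 + 2 * lam / 3))
    (-(2 * lam / 3) * (-3 + 3 * ε - ε ^ 2) + 16 * s * lam ^ 2 * (1 - ε) ^ 5) ε

theorem exists_abs_neumannRemainder_le (M lam : ℝ) :
    ∃ C > 0, ∀ ε ∈ Set.Icc (0 : ℝ) 1, ∀ p ∈ Set.Icc (-1 : ℝ) 1, ∀ q ∈ Set.Icc (-1 : ℝ) 1,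
      ∀ r ∈ Set.Icc (-1 : ℝ) 1, ∀ s ∈ Set.Icc (-1 : ℝ) 1,
        |neumannRemainder M lam ε p q r s| ≤ C := by
  have hK : IsCompact (Set.Icc (0 : ℝ) 1 ×ˢ Set.Icc (-1 : ℝ) 1 ×ˢ Set.Icc (-1 : ℝ) 1 ×ˢ
      Set.Icc (-1 : ℝ) 1 ×ˢ Set.Icc (-1 : ℝ) 1) :=
    isCompact_Icc.prod (isCompact_Icc.prod (isCompact_Icc.prod (isCompact_Icc.prod isCompact_Icc)))
  have hcont : Continuous fun z : ℝ × ℝ × ℝ × ℝ × ℝ =>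
      neumannRemainder M lam z.1 z.2.1 z.2.2.1 z.2.2.2.1 z.2.2.2.2 := by
    unfold neumannRemainder quadraticMulRemainder
    fun_prop
  obtain ⟨C, hC⟩ := hK.exists_bound_of_continuousOn hcont.continuousOn
  refine ⟨max C 1, by positivity, fun ε hε p hp q hq r hr s hs => le_max_of_le_left ?_⟩
  exact hC (ε, p, q, r, s) ⟨hε, hp, hq, hr, hs⟩


/-- Two-term expansion in `ε` of the normalized transcendental function
`G(ε)/(2√(λε))` characterizing the positive eigenvalues of the one-dimensional
Neumann problem: it equals `M − λM²/2 + (λM²/6)(1 + λ(2 + M/2)) ε + O(ε²)` as `ε → 0⁺`. -/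
theorem neumann_1d_equation_expansion (M lam : ℝ) (hM : 0 < M) (hlam : 0 < lam) :
    ∃ C > (0:ℝ), ∃ δ > (0:ℝ), ∀ ε ∈ Set.Ioo (0:ℝ) δ, ε < 1 →
      0 < M / (2 * ε) - 1 + ε →
      |1 / (2 * Real.sqrt (lam * ε)) *
          (2 * Real.sqrt (ε * (M / (2 * ε) - 1 + ε))
              * Real.cos (2 * Real.sqrt (lam * ε) * (1 - ε))
              * Real.sin (2 * ε * Real.sqrt (lam * (M / (2 * ε) - 1 + ε)))
            + (-(M / (2 * ε)) + 1
                + (M / (2 * ε) - 1 + 2 * ε)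
                  * Real.cos (2 * ε * Real.sqrt (lam * (M / (2 * ε) - 1 + ε))))
              * Real.sin (2 * Real.sqrt (lam * ε) * (1 - ε)))
        - M + lam * M ^ 2 / 2
        - lam * M ^ 2 / 6 * (1 + lam * (2 + M / 2)) * ε| ≤ C * ε ^ 2 := by
  obtain ⟨C, hC, hR⟩ := exists_abs_neumannRemainder_le M lam
  refine ⟨C, hC, min 1 (min (1 / (4 * lam)) (1 / (2 * lam * M))), by positivity, ?_⟩
  rintro ε ⟨hε, hεδ⟩ hε1 hρ
  have hε_lam : ε * (4 * lam) < 1 := by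
    rw [← lt_div_iff₀ (by positivity)]
    exact hεδ.trans_le ((min_le_right _ _).trans (min_le_left _ _))
  have hε_lamM : ε * (2 * lam * M) < 1 := by
    rw [← lt_div_iff₀ (by positivity)]
    exact hεδ.trans_le ((min_le_right _ _).trans (min_le_right _ _))
  have hρε : M / (2 * ε) * ε = M / 2 := by field_simp
  set ρ := M / (2 * ε) - 1 + ε with hρ_def
  set a := 2 * Real.sqrt (lam * ε) * (1 - ε) with ha_def
  set b := 2 * ε * Real.sqrt (lam * ρ) with hb_def
  have hσ : 0 < Real.sqrt (lam * ε) := Real.sqrt_pos.2 (by positivity)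
  have hσ_sq : Real.sqrt (lam * ε) ^ 2 = lam * ε := Real.sq_sqrt (by positivity)
  have ha_sq : a ^ 2 = 4 * lam * ε * (1 - ε) ^ 2 := by
    rw [ha_def, mul_pow, mul_pow, hσ_sq]
    ring
  have hb_sq : b ^ 2 = 2 * lam * ε * (M - 2 * ε + 2 * ε ^ 2) := by
    rw [hb_def, mul_pow, Real.sq_sqrt (by positivity), hρ_def]
    linear_combination 4 * ε * lam * hρε
  have hb_sqrt : 2 * Real.sqrt (ε * ρ) = b / Real.sqrt (lam * ε) := by
    rw [eq_div_iff hσ.ne', mul_assoc, ← Real.sqrt_mul (by positivity),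
      show ε * ρ * (lam * ε) = ε ^ 2 * (lam * ρ) by ring, Real.sqrt_mul (by positivity),
      Real.sqrt_sq hε.le, hb_def, mul_assoc]
  have ha_le : |a| ≤ 1 := by
    rw [← sq_le_one_iff_abs_le_one, ha_sq]
    have : (1 - ε) ^ 2 ≤ 1 := by nlinarith
    nlinarith [mul_pos hε hlam]
  have hb_le : |b| ≤ 1 := by
    rw [← sq_le_one_iff_abs_le_one, hb_sq]
    have : M - 2 * ε + 2 * ε ^ 2 ≤ M := by nlinarith
    nlinarith [mul_pos hε hlam]
  obtain ⟨p, hp, hcos_b⟩ := Real.exists_cos_eq_quartic_add hb_le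
  obtain ⟨q, hq, hsin_b⟩ := Real.exists_sin_eq_cubic_add hb_le
  obtain ⟨r, hr, hcos_a⟩ := Real.exists_cos_eq_quadratic_add ha_le
  obtain ⟨s, hs, hsin_a⟩ := Real.exists_sin_eq_cubic_add ha_le
  have hbound := hR ε ⟨hε.le, hε1.le⟩ p hp q hq r hr s hs
  have hnormalized : 1 / (2 * Real.sqrt (lam * ε)) *
      (2 * Real.sqrt (ε * ρ) * Real.cos a * Real.sin b
        + (-(M / (2 * ε)) + 1 + (M / (2 * ε) - 1 + 2 * ε) * Real.cos b) * Real.sin a) =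
      b ^ 2 / (2 * lam * ε) * (1 - a ^ 2 / 2 + r * (a ^ 2) ^ 2)
          * (1 - b ^ 2 / 6 + q * (b ^ 2) ^ 2)
        + (2 * ε + (M / (2 * ε) - 1 + 2 * ε)
            * (-(b ^ 2) / 2 + (b ^ 2) ^ 2 / 24 + p * (b ^ 2) ^ 3))
          * ((1 - ε) * (1 - a ^ 2 / 6 + s * (a ^ 2) ^ 2)) := by
    have ha_div : a / (2 * Real.sqrt (lam * ε)) = 1 - ε := by
      rw [ha_def]
      field_simp
    have hb_div : b / Real.sqrt (lam * ε) * b / (2 * Real.sqrt (lam * ε))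
        = b ^ 2 / (2 * lam * ε) := by
      rw [show 2 * lam * ε = 2 * Real.sqrt (lam * ε) ^ 2 by rw [hσ_sq]; ring]
      field_simp
    rw [hb_sqrt, hcos_a, hcos_b, hsin_a, hsin_b, ← ha_div, ← hb_div]
    ring
  have hexpansion : 1 / (2 * Real.sqrt (lam * ε)) *
      (2 * Real.sqrt (ε * ρ) * Real.cos a * Real.sin b
        + (-(M / (2 * ε)) + 1 + (M / (2 * ε) - 1 + 2 * ε) * Real.cos b) * Real.sin a)
      - M + lam * M ^ 2 / 2 - lam * M ^ 2 / 6 * (1 + lam * (2 + M / 2)) * ε =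
      neumannRemainder M lam ε p q r s * ε ^ 2 := by
    rw [hnormalized, ha_sq, hb_sq]
    unfold neumannRemainder quadraticMulRemainder
    field_simp
    ring
  rw [hexpansion, abs_mul, abs_of_pos (pow_pos hε 2)]
  gcongr
end

section
/- Fix M > 0. Suppose δ > 0 and Λ : (0, δ) → ℝ is a function such that for every ε ∈ (0, δ), Λ(ε) > 0 and Λ(ε) is an eigenvalue of the Neumann problem (Neu1) with parameter ε as defined in the context, and suppose Λ(ε) → 2/M as ε → 0⁺. Then Λ(ε) = 2/M + (2/3)·(2/M + 4/M²)·ε + o(ε) as ε → 0⁺; that is, (Λ(ε) − 2/M − (2/3)·(2/M + 4/M²)·ε)/ε → 0 as ε → 0⁺. -/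
open Real Set Filter Topology

/-- First integral of `u'' = -k² u` on a closed interval: the Wronskian of `u` with
`cos (k x + φ)` is constant. -/
theorem deriv_mul_cos_add_mul_sin_eq {u : ℝ → ℝ} {p q k : ℝ} (φ : ℝ)
    (hu : ∀ x ∈ Icc p q, DifferentiableAt ℝ u x)
    (hc : ContinuousOn (deriv u) (Icc p q))
    (ho : ∀ x ∈ Ioo p q, DifferentiableAt ℝ (deriv u) x ∧ deriv (deriv u) x = -(k ^ 2 * u x))
    {x y : ℝ} (hx : x ∈ Icc p q) (hy : y ∈ Icc p q) :
    deriv u x * cos (k * x + φ) + k * u x * sin (k * x + φ) =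
      deriv u y * cos (k * y + φ) + k * u y * sin (k * y + φ) := by
  wlog hxy : x < y generalizing x y
  · rcases (not_lt.mp hxy).eq_or_lt with h | h
    · rw [h]
    · exact (this hy hx h).symm
  have hsub : Icc x y ⊆ Icc p q := Icc_subset_Icc hx.1 hy.2
  have huc : ContinuousOn u (Icc x y) := fun z hz =>
    (hu z (hsub hz)).continuousAt.continuousWithinAt
  have hcont : ContinuousOn
      (fun z => deriv u z * cos (k * z + φ) + k * u z * sin (k * z + φ)) (Icc x y) := by
    have := hc.mono hsub
    fun_prop
  obtain ⟨c, -, h⟩ := exists_hasDerivAt_eq_slope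
    (fun z => deriv u z * cos (k * z + φ) + k * u z * sin (k * z + φ)) (fun _ => 0) hxy hcont
    (by
      intro z hz
      obtain ⟨hd, he⟩ := ho z ⟨hx.1.trans_lt hz.1, hz.2.trans_le hy.2⟩
      have h1 := hd.hasDerivAt
      have h2 := (hu z (hsub (Ioo_subset_Icc_self hz))).hasDerivAt
      have h3 : HasDerivAt (fun z : ℝ => k * z + φ) k z := by
        simpa using ((hasDerivAt_id z).const_mul k).add_const φ
      refine ((h1.mul h3.cos).add ((h2.const_mul k).mul h3.sin)).congr_deriv ?_
      rw [he]
      ring)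
  have hne : y - x ≠ 0 := (sub_pos.mpr hxy).ne'
  rw [eq_div_iff hne] at h
  linarith

/-- Companion of `deriv_mul_cos_add_mul_sin_eq` for `sin (k x + φ)`. -/
theorem deriv_mul_sin_sub_mul_cos_eq {u : ℝ → ℝ} {p q k : ℝ} (φ : ℝ)
    (hu : ∀ x ∈ Icc p q, DifferentiableAt ℝ u x)
    (hc : ContinuousOn (deriv u) (Icc p q))
    (ho : ∀ x ∈ Ioo p q, DifferentiableAt ℝ (deriv u) x ∧ deriv (deriv u) x = -(k ^ 2 * u x))
    {x y : ℝ} (hx : x ∈ Icc p q) (hy : y ∈ Icc p q) :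
    deriv u x * sin (k * x + φ) - k * u x * cos (k * x + φ) =
      deriv u y * sin (k * y + φ) - k * u y * cos (k * y + φ) := by
  have h := deriv_mul_cos_add_mul_sin_eq (φ - π / 2) hu hc ho hx hy
  simp only [← add_sub_assoc, cos_sub_pi_div_two, sin_sub_pi_div_two] at h
  linarith

/-- A solution of `u'' = -k² u` with vanishing Cauchy data at one point vanishes. -/
theorem eq_zero_of_cauchy_data_eq_zero {u : ℝ → ℝ} {p q k : ℝ} (hk : 0 < k)
    (hu : ∀ x ∈ Icc p q, DifferentiableAt ℝ u x)
    (hc : ContinuousOn (deriv u) (Icc p q))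
    (ho : ∀ x ∈ Ioo p q, DifferentiableAt ℝ (deriv u) x ∧ deriv (deriv u) x = -(k ^ 2 * u x))
    {x y : ℝ} (hx : x ∈ Icc p q) (hy : y ∈ Icc p q) (h0 : u y = 0) (h1 : deriv u y = 0) :
    u x = 0 := by
  have h := deriv_mul_cos_add_mul_sin_eq (π / 2 - k * x) hu hc ho hx hy
  simpa [h0, h1, hk.ne'] using h

/-- The characteristic equation of the odd Neumann eigenfunctions, valid as soon as both phases
`a ε` and `b (1 - ε)` are below `1`. -/
theorem IsNeumannEV1D.characteristic_equation {M ε lam a b : ℝ} (h : IsNeumannEV1D M ε lam)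
    (hε : 0 < ε) (hε1 : ε < 1) (ha : 0 < a) (hb : 0 < b)
    (ha2 : a ^ 2 = lam * (M / (2 * ε) - 1 + ε)) (hb2 : b ^ 2 = lam * ε)
    (hα : a * ε < 1) (hβ : b * (1 - ε) < 1) :
    a * sin (a * ε) * sin (b * (1 - ε)) = b * cos (a * ε) * cos (b * (1 - ε)) := by
  obtain ⟨u, ⟨x₀, hx₀, hne⟩, hu, hc, ho, hl, hr⟩ := h
  have s1 : Icc (-1) (-1 + ε) ⊆ Icc (-1 : ℝ) 1 := Icc_subset_Icc le_rfl (by linarith)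
  have s2 : Icc (-1 + ε) (1 - ε) ⊆ Icc (-1 : ℝ) 1 := Icc_subset_Icc (by linarith) (by linarith)
  have s3 : Icc (1 - ε) 1 ⊆ Icc (-1 : ℝ) 1 := Icc_subset_Icc (by linarith) le_rfl
  have o1 : ∀ x ∈ Ioo (-1) (-1 + ε), DifferentiableAt ℝ (deriv u) x ∧
      deriv (deriv u) x = -(a ^ 2 * u x) := by
    intro x hx
    obtain ⟨hd, he⟩ := ho x ⟨hx.1, by linarith [hx.2]⟩ hx.2.ne (by linarith [hx.2])
    rw [rho1D, if_neg (fun hn => hn.1.not_gt hx.2)] at he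
    exact ⟨hd, by rw [ha2, ← he, neg_neg]⟩
  have o2 : ∀ x ∈ Ioo (-1 + ε) (1 - ε), DifferentiableAt ℝ (deriv u) x ∧
      deriv (deriv u) x = -(b ^ 2 * u x) := by
    intro x hx
    obtain ⟨hd, he⟩ := ho x ⟨by linarith [hx.1], by linarith [hx.2]⟩ hx.1.ne' hx.2.ne
    rw [rho1D, if_pos ⟨hx.1, hx.2⟩] at he
    exact ⟨hd, by rw [hb2, ← he, neg_neg]⟩
  have o3 : ∀ x ∈ Ioo (1 - ε) 1, DifferentiableAt ℝ (deriv u) x ∧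
      deriv (deriv u) x = -(a ^ 2 * u x) := by
    intro x hx
    obtain ⟨hd, he⟩ := ho x ⟨by linarith [hx.1], hx.2⟩ (by linarith [hx.1]) hx.1.ne'
    rw [rho1D, if_neg (fun hn => hn.2.not_gt hx.1)] at he
    exact ⟨hd, by rw [ha2, ← he, neg_neg]⟩
  have u1 := fun x hx => hu x (s1 hx)
  have u2 := fun x hx => hu x (s2 hx)
  have u3 := fun x hx => hu x (s3 hx)
  have c1 := hc.mono s1
  have c2 := hc.mono s2
  have c3 := hc.mono s3
  have m1 : -1 + ε ∈ Icc (-1) (-1 + ε) := ⟨by linarith, le_rfl⟩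
  have m2 : -1 + ε ∈ Icc (-1 + ε) (1 - ε) := ⟨le_rfl, by linarith⟩
  have m2' : 1 - ε ∈ Icc (-1 + ε) (1 - ε) := ⟨by linarith, le_rfl⟩
  have m3 : 1 - ε ∈ Icc (1 - ε) 1 := ⟨le_rfl, by linarith⟩
  have e1 := deriv_mul_cos_add_mul_sin_eq a u1 c1 o1 m1 (y := -1) ⟨le_rfl, by linarith⟩
  rw [show a * (-1 + ε) + a = a * ε by ring, show a * -1 + a = 0 by ring, hl, sin_zero] at e1
  have e3 := deriv_mul_cos_add_mul_sin_eq (-a) u3 c3 o3 m3 (y := 1) ⟨by linarith, le_rfl⟩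
  rw [show a * (1 - ε) + -a = -(a * ε) by ring, show a * 1 + -a = 0 by ring, hr, sin_zero,
    cos_neg, sin_neg] at e3
  have e2 := deriv_mul_cos_add_mul_sin_eq 0 u2 c2 o2 m2' m2
  have e2' := deriv_mul_sin_sub_mul_cos_eq 0 u2 c2 o2 m2' m2
  rw [show b * (-1 + ε) + 0 = -(b * (1 - ε)) by ring, add_zero, cos_neg, sin_neg] at e2 e2'
  have pos : ∀ t : ℝ, 0 < t → t < 1 → 0 < sin t ∧ 0 < cos t := fun t h0 h1 =>
    ⟨sin_pos_of_pos_of_le_one h0 h1.le,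
      cos_pos_of_le_one (by rw [abs_of_pos h0]; exact h1.le)⟩
  obtain ⟨hS, hC⟩ := pos _ (mul_pos ha hε) hα
  obtain ⟨hs, hc'⟩ := pos _ (mul_pos hb (sub_pos.mpr hε1)) hβ
  generalize sin (a * ε) = S, cos (a * ε) = C, sin (b * (1 - ε)) = s,
    cos (b * (1 - ε)) = c at *
  have k1 : (a * S * c + b * s * C) * (u (1 - ε) + u (-1 + ε)) = 0 := by
    linear_combination C * e2 + c * e1 - c * e3
  have k2 : (a * S * s - b * C * c) * (u (1 - ε) - u (-1 + ε)) = 0 := by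
    linear_combination C * e2' - s * e1 - s * e3
  have hpos : 0 < a * S * c + b * s * C := by positivity
  have hsum := (mul_eq_zero.mp k1).resolve_left hpos.ne'
  rcases mul_eq_zero.mp k2 with h | hdiff
  · linarith
  exfalso
  have v1 : u (1 - ε) = 0 := by linarith
  have v2 : u (-1 + ε) = 0 := by linarith
  have d1 : deriv u (1 - ε) = 0 := by simpa [v1, hC.ne'] using e3
  have d2 : deriv u (-1 + ε) = 0 := by simpa [v2, hC.ne'] using e1
  refine hne ?_
  rcases le_total x₀ (-1 + ε) with h | h
  · exact eq_zero_of_cauchy_data_eq_zero ha u1 c1 o1 ⟨hx₀.1, h⟩ m1 v2 d2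
  rcases le_total x₀ (1 - ε) with h' | h'
  · exact eq_zero_of_cauchy_data_eq_zero hb u2 c2 o2 ⟨h, h'⟩ m2 v2 d2
  · exact eq_zero_of_cauchy_data_eq_zero ha u3 c3 o3 ⟨h', hx₀.2⟩ m3 v1 d1

/-- The remainder `g` in `tan t = t (1 + t² g(t))`. -/
noncomputable def tanRemainder (t : ℝ) : ℝ := (sin t - t * cos t) / t ^ 3 / cos t

theorem sin_eq_cos_mul_tanRemainder {t : ℝ} (ht : t ≠ 0) (hc : cos t ≠ 0) :
    sin t = cos t * (t * (1 + t ^ 2 * tanRemainder t)) := by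
  rw [tanRemainder]
  field_simp
  ring

theorem tendsto_tanRemainder : Tendsto tanRemainder (𝓝[>] 0) (𝓝 (1 / 3)) := by
  have hid : Tendsto (fun t : ℝ => t) (𝓝[>] 0) (𝓝 0) := nhdsWithin_le_nhds
  have h1 : Tendsto (fun t : ℝ => (sin t - t * cos t) / t ^ 3) (𝓝[>] 0) (𝓝 (1 / 3)) := by
    rw [tendsto_iff_norm_sub_tendsto_zero]
    refine squeeze_zero' (Eventually.of_forall fun _ => norm_nonneg _) ?_ hid
    filter_upwards [Ioo_mem_nhdsGT (zero_lt_one' ℝ)] with t ht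
    have h0 := ht.1
    have habs : |t| ≤ 1 := by rw [abs_of_pos h0]; exact ht.2.le
    have hs := abs_le.mp (sin_bound habs)
    have hc := abs_le.mp (cos_bound habs)
    rw [abs_of_pos h0] at hs hc
    have hc1 := mul_le_mul_of_nonneg_left hc.1 h0.le
    have hc2 := mul_le_mul_of_nonneg_left hc.2 h0.le
    have h5 : t * t ^ 4 ≤ t ^ 4 := mul_le_of_le_one_left (by positivity) ht.2.le
    have h4 : 0 < t ^ 4 := by positivity
    have h3 : 0 < t ^ 3 := by positivity
    rw [Real.norm_eq_abs, show (sin t - t * cos t) / t ^ 3 - 1 / 3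
      = (sin t - t * cos t - t ^ 3 / 3) / t ^ 3 by field_simp, abs_div, abs_of_pos h3,
      div_le_iff₀ h3, abs_le]
    constructor <;> nlinarith
  have h2 : Tendsto cos (𝓝[>] 0) (𝓝 1) := by
    simpa using (continuous_cos.tendsto 0).mono_left (nhdsWithin_le_nhds (s := Ioi 0))
  have h := h1.div h2 one_ne_zero
  rw [div_one] at h
  exact h

/-- Asymptotic expansion of the branch of positive Neumann eigenvalues converging to the
Steklov eigenvalue `2/M`: `Λ(ε) = 2/M + (2/3)(2/M + 4/M²) ε + o(ε)` as `ε → 0⁺`. -/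
theorem neumann_1d_eigenvalue_branch_expansion
    (M : ℝ) (hM : 0 < M) (δ : ℝ) (hδ : 0 < δ) (Λ : ℝ → ℝ)
    (hEV : ∀ ε ∈ Set.Ioo (0:ℝ) δ, 0 < Λ ε ∧ IsNeumannEV1D M ε (Λ ε))
    (hlim : Filter.Tendsto Λ (nhdsWithin 0 (Set.Ioi 0)) (nhds (2 / M))) :
    Filter.Tendsto (fun ε : ℝ => (Λ ε - 2 / M - 2 / 3 * (2 / M + 4 / M ^ 2) * ε) / ε)
      (nhdsWithin 0 (Set.Ioi 0)) (nhds 0) := by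
  have hid : Tendsto (fun ε : ℝ => ε) (𝓝[>] 0) (𝓝 0) := nhdsWithin_le_nhds
  have hmass : Tendsto (fun ε : ℝ => M / 2 - ε + ε ^ 2) (𝓝[>] 0) (𝓝 (M / 2)) := by
    simpa using (hid.const_sub (M / 2)).add (hid.pow 2)
  have hsub : Tendsto (fun ε : ℝ => 1 - ε) (𝓝[>] 0) (𝓝 1) := by
    simpa using hid.const_sub 1
  -- the phases of the odd eigenfunction in the boundary layer and in the middle interval
  set α : ℝ → ℝ := fun ε => √(Λ ε * (M / (2 * ε) - 1 + ε)) * ε with hα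
  set β : ℝ → ℝ := fun ε => √(Λ ε * ε) * (1 - ε) with hβ
  have hsmall : ∀ᶠ ε in 𝓝[>] (0 : ℝ), 0 < ε ∧ ε < 1 ∧ ε < δ ∧ 0 < M / 2 - ε + ε ^ 2 := by
    filter_upwards [self_mem_nhdsWithin, Ioo_mem_nhdsGT (zero_lt_one' ℝ), Ioo_mem_nhdsGT hδ,
      hmass.eventually_const_lt (half_pos hM)] with ε h0 h1 h2 h3
    exact ⟨h0, h1.2, h2.2, h3⟩
  have hmass_eq : ∀ ε : ℝ, 0 < ε → M / (2 * ε) - 1 + ε = (M / 2 - ε + ε ^ 2) / ε := by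
    intro ε hε
    field_simp
  have hβlim : Tendsto β (𝓝[>] 0) (𝓝 0) := by
    simpa using (hlim.mul hid).sqrt.mul hsub
  have hαlim : Tendsto α (𝓝[>] 0) (𝓝 0) := by
    have h : Tendsto (fun ε => √(Λ ε * (M / 2 - ε + ε ^ 2) * ε)) (𝓝[>] 0) (𝓝 0) := by
      simpa using ((hlim.mul hmass).mul hid).sqrt
    refine h.congr' ?_
    filter_upwards [self_mem_nhdsWithin] with ε (hε : 0 < ε)
    rw [hα]
    dsimp only
    rw [← Real.sqrt_sq hε.le, ← Real.sqrt_mul' _ (sq_nonneg ε), Real.sqrt_sq hε.le,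
      hmass_eq ε hε]
    congr 1
    field_simp
  have hpos : ∀ᶠ ε in 𝓝[>] (0 : ℝ), 0 < α ε ∧ 0 < β ε := by
    filter_upwards [hsmall] with ε ⟨h0, h1, h2, h3⟩
    have hL := (hEV ε ⟨h0, h2⟩).1
    simp only [hα, hβ]
    rw [hmass_eq ε h0]
    have := sub_pos.mpr h1
    constructor <;> positivity
  have hgα : Tendsto (fun ε => tanRemainder (α ε)) (𝓝[>] 0) (𝓝 (1 / 3)) :=
    tendsto_tanRemainder.comp
      (tendsto_nhdsWithin_iff.mpr ⟨hαlim, hpos.mono fun _ h => h.1⟩)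
  have hgβ : Tendsto (fun ε => tanRemainder (β ε)) (𝓝[>] 0) (𝓝 (1 / 3)) :=
    tendsto_tanRemainder.comp
      (tendsto_nhdsWithin_iff.mpr ⟨hβlim, hpos.mono fun _ h => h.2⟩)
  set p : ℝ → ℝ := fun ε => Λ ε * (M / 2 - ε + ε ^ 2) * tanRemainder (α ε) with hp
  set q : ℝ → ℝ := fun ε => Λ ε * (1 - ε) ^ 2 * tanRemainder (β ε) with hq
  have hplim : Tendsto p (𝓝[>] 0) (𝓝 (2 / M * (M / 2) * (1 / 3))) := (hlim.mul hmass).mul hgα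
  have hqlim : Tendsto q (𝓝[>] 0) (𝓝 (2 / M * 1 ^ 2 * (1 / 3))) :=
    (hlim.mul (hsub.pow 2)).mul hgβ
  have key : ∀ᶠ ε in 𝓝[>] (0 : ℝ),
      Λ ε * (M / 2 - ε + ε ^ 2) * (1 - ε) * (1 + ε * p ε) * (1 + ε * q ε) = 1 := by
    filter_upwards [hsmall, hpos, hαlim.eventually_lt_const zero_lt_one,
      hβlim.eventually_lt_const zero_lt_one] with ε ⟨h0, h1, h2, h3⟩ ⟨hα0, hβ0⟩ hα1 hβ1
    obtain ⟨hL, hev⟩ := hEV ε ⟨h0, h2⟩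
    have hA : 0 < Λ ε * (M / (2 * ε) - 1 + ε) := by
      rw [hmass_eq ε h0]
      positivity
    have hB : 0 < Λ ε * ε := mul_pos hL h0
    have ha2 := Real.sq_sqrt hA.le
    have hb2 := Real.sq_sqrt hB.le
    have hchar := hev.characteristic_equation h0 h1 (Real.sqrt_pos.mpr hA)
      (Real.sqrt_pos.mpr hB) ha2 hb2 hα1 hβ1
    have hcα : cos (α ε) ≠ 0 := (cos_pos_of_le_one (by rw [abs_of_pos hα0]; exact hα1.le)).ne'
    have hcβ : cos (β ε) ≠ 0 := (cos_pos_of_le_one (by rw [abs_of_pos hβ0]; exact hβ1.le)).ne'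
    have hb := Real.sqrt_pos.mpr hB
    change √(Λ ε * (M / (2 * ε) - 1 + ε)) * sin (α ε) * sin (β ε) =
      √(Λ ε * ε) * cos (α ε) * cos (β ε) at hchar
    rw [sin_eq_cos_mul_tanRemainder hα0.ne' hcα, sin_eq_cos_mul_tanRemainder hβ0.ne' hcβ]
      at hchar
    have hαsq : α ε ^ 2 = ε * (Λ ε * (M / 2 - ε + ε ^ 2)) := by
      simp only [hα]
      rw [mul_pow, ha2, hmass_eq ε h0]
      field_simp
    have hβsq : β ε ^ 2 = ε * (Λ ε * (1 - ε) ^ 2) := by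
      simp only [hβ]
      rw [mul_pow, hb2]
      ring
    have hpα : 1 + α ε ^ 2 * tanRemainder (α ε) = 1 + ε * p ε := by rw [hαsq, hp]; ring
    have hqβ : 1 + β ε ^ 2 * tanRemainder (β ε) = 1 + ε * q ε := by rw [hβsq, hq]; ring
    rw [hpα, hqβ] at hchar
    have hαm : √(Λ ε * (M / (2 * ε) - 1 + ε)) * α ε = Λ ε * (M / 2 - ε + ε ^ 2) := by
      simp only [hα]
      rw [← mul_assoc, Real.mul_self_sqrt hA.le, hmass_eq ε h0]
      field_simp
    have hβm : β ε = √(Λ ε * ε) * (1 - ε) := rfl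
    refine mul_left_cancel₀ (mul_ne_zero (mul_ne_zero hb.ne' hcα) hcβ) ?_
    linear_combination hchar
      - √(Λ ε * ε) * cos (α ε) * cos (β ε) * (1 - ε) * (1 + ε * p ε) * (1 + ε * q ε) * hαm
      - √(Λ ε * (M / (2 * ε) - 1 + ε)) * α ε * cos (α ε) * cos (β ε) * (1 + ε * p ε) *
        (1 + ε * q ε) * hβm
  set r₁ : ℝ → ℝ := fun ε => -(2 / M * (1 - ε)) - 1 + ε * (2 / M * (1 - ε)) with hr₁
  set r₂ : ℝ → ℝ := fun ε => p ε + q ε + ε * (p ε * q ε) with hr₂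
  have hr₁lim : Tendsto r₁ (𝓝[>] 0) (𝓝 (-(2 / M * 1) - 1 + 0 * (2 / M * 1))) :=
    ((hsub.const_mul (2 / M)).neg.sub_const 1).add (hid.mul (hsub.const_mul (2 / M)))
  have hr₂lim : Tendsto r₂ (𝓝[>] 0) (𝓝 _) :=
    (hplim.add hqlim).add (hid.mul (hplim.mul hqlim))
  have hlim' := ((hlim.mul ((hr₁lim.add hr₂lim).add (hid.mul (hr₁lim.mul hr₂lim)))).neg).sub_const
    (2 / 3 * (2 / M + 4 / M ^ 2))
  have hM' := hM.ne'
  refine (hlim'.congr' ?_).trans (le_of_eq ?_)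
  · filter_upwards [key, hsmall] with ε hk ⟨h0, _⟩
    have hrel : Λ ε - 2 / M = -(Λ ε * (r₁ ε + r₂ ε + ε * (r₁ ε * r₂ ε))) * ε := by
      have h1 : (M / 2 - ε + ε ^ 2) * (1 - ε) = M / 2 * (1 + ε * r₁ ε) := by
        simp only [hr₁]
        field_simp
        ring
      have h2 : (1 + ε * p ε) * (1 + ε * q ε) = 1 + ε * r₂ ε := by
        simp only [hr₂]
        ring
      have h3 : Λ ε * (M / 2) * ((1 + ε * r₁ ε) * (1 + ε * r₂ ε)) = 1 := by
        linear_combination hk - Λ ε * (1 + ε * p ε) * (1 + ε * q ε) * h1 -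
          Λ ε * (M / 2) * (1 + ε * r₁ ε) * h2
      field_simp
      linear_combination 2 * h3
    rw [eq_div_iff h0.ne']
    linear_combination -hrel
  · congr 1
    field_simp
    ring
end

section
/- Fix M > 0. Let (ε_n) be a sequence in (0,1) with ε_n → 0, and for each n let λ_n > 0 be an eigenvalue of the Neumann problem (Neu1) with parameter ε_n as defined in the context. If λ_n converges to a real number λ̄ as n → ∞, then λ̄ = 0 or λ̄ = 2/M. In particular, any sequence of positive Neumann eigenvalues staying uniformly away from 0 and 2/M must diverge to +∞ along ε_n → 0. -/
/-- A function whose derivative stays within `L` of a constant `k` is within `L (b - a)` of being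
affine with slope `k`. -/
lemma abs_sub_sub_mul_le_of_abs_deriv_sub_le {f : ℝ → ℝ} {a b k L : ℝ} (hab : a ≤ b)
    (hc : ContinuousOn f (Set.Icc a b)) (hd : ∀ x ∈ Set.Ioo a b, DifferentiableAt ℝ f x)
    (hL : ∀ x ∈ Set.Ioo a b, |deriv f x - k| ≤ L) :
    |f b - f a - k * (b - a)| ≤ L * (b - a) := by
  rcases hab.eq_or_lt with rfl | hlt
  · simp
  obtain ⟨x, hx, hfx⟩ := exists_deriv_eq_slope f hlt hc
    fun y hy => (hd y hy).differentiableWithinAt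
  have hpos : 0 < b - a := sub_pos.2 hlt
  rw [eq_div_iff hpos.ne'] at hfx
  rw [← hfx, ← sub_mul, abs_mul, abs_of_pos hpos]
  exact mul_le_mul_of_nonneg_right (hL x hx) hpos.le

/-- The special case `k = 0` of `abs_sub_sub_mul_le_of_abs_deriv_sub_le`. -/
lemma abs_sub_le_of_abs_deriv_le {f : ℝ → ℝ} {a b L : ℝ} (hab : a ≤ b)
    (hc : ContinuousOn f (Set.Icc a b)) (hd : ∀ x ∈ Set.Ioo a b, DifferentiableAt ℝ f x)
    (hL : ∀ x ∈ Set.Ioo a b, |deriv f x| ≤ L) :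
    |f b - f a| ≤ L * (b - a) := by
  simpa using abs_sub_sub_mul_le_of_abs_deriv_sub_le (k := 0) hab hc hd (by simpa using hL)

lemma rho1D_of_mem_Ioo {M ε x : ℝ} (hx : x ∈ Set.Ioo (-1 + ε) (1 - ε)) : rho1D M ε x = ε :=
  if_pos hx

lemma rho1D_of_notMem_Ioo {M ε x : ℝ} (hx : x ∉ Set.Ioo (-1 + ε) (1 - ε)) :
    rho1D M ε x = M / (2 * ε) - 1 + ε :=
  if_neg hx

/-- If a function has mass density `ρ_ε` in a boundary layer and differs by at most `D W ε` from
the constant `a`, then its second derivative there differs from the concentrated one by a bounded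
amount. -/
lemma abs_boundary_layer_source_le {M ε lam K D W a v : ℝ} (hM : 0 < M) (hε : ε ∈ Set.Ioo (0 : ℝ) 1)
    (hlam : 0 < lam) (hK : lam ≤ K) (hv : |v| ≤ W) (hva : |v - a| ≤ D * W * ε) :
    |-(lam * (M / (2 * ε) - 1 + ε) * v) - -(lam * (M / (2 * ε)) * a)| ≤
      K * (1 + M / 2 * D) * W := by
  obtain ⟨h0, h1⟩ := hε
  have hsplit : -(lam * (M / (2 * ε) - 1 + ε) * v) - -(lam * (M / (2 * ε)) * a) =
      lam * ((1 - ε) * v - M / (2 * ε) * (v - a)) := by ring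
  have hmass : |(1 - ε) * v| ≤ W := by
    rw [abs_mul, abs_of_pos (sub_pos.2 h1)]
    nlinarith [abs_nonneg v]
  have hosc : |M / (2 * ε) * (v - a)| ≤ M / 2 * D * W := by
    rw [abs_mul, abs_of_pos (by positivity : 0 < M / (2 * ε))]
    calc M / (2 * ε) * |v - a| ≤ M / (2 * ε) * (D * W * ε) := by gcongr
      _ = M / 2 * D * W := by field_simp
  have hsum : |(1 - ε) * v - M / (2 * ε) * (v - a)| ≤ (1 + M / 2 * D) * W := by
    have := abs_sub ((1 - ε) * v) (M / (2 * ε) * (v - a))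
    linarith
  rw [hsplit, abs_mul, abs_of_pos hlam, mul_assoc]
  exact mul_le_mul hK hsum (abs_nonneg _) (hlam.le.trans hK)

/-- Algebraic stability of the limiting Steklov problem: if `a`, `b` (boundary values) and `s`, `t`
(slopes) satisfy the limiting relations up to an error `δ`, and the size `W` is controlled by the
boundary values, then `p |p - 1| W` is controlled by `δ`. -/
lemma mul_abs_sub_one_mul_le {p P a b s t δ W : ℝ} (hp : 0 < p) (hpP : p ≤ P)
    (ha : |s + p * a| ≤ δ) (hb : |t - p * b| ≤ δ) (hst : |t - s| ≤ δ)
    (hab : |b - a - 2 * s| ≤ δ) (hW : W ≤ 2 * |a| + |b| + δ) :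
    p * |p - 1| * W ≤ (12 + 15 * P) * (P + 1) * δ := by
  have hδ : 0 ≤ δ := (abs_nonneg _).trans ha
  have hp1 : |p - 1| ≤ P + 1 := abs_le.2 ⟨by linarith, by linarith⟩
  have hadd : p * |a + b| ≤ 3 * δ := by
    rw [show p * |a + b| = |p * (a + b)| by rw [abs_mul, abs_of_pos hp]]
    rw [abs_le] at ha hb hst ⊢
    constructor <;> linarith
  have hsub : |p - 1| * |b - a| ≤ 4 * δ := by
    rw [← abs_mul]
    rw [abs_le] at ha hb hst hab ⊢
    constructor <;> linarith
  have hsize : W ≤ 2 * |a + b| + 2 * |b - a| + δ := by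
    have h1 : 2 * |a| ≤ |a + b| + |b - a| := by
      rcases abs_cases a with h | h <;> rcases abs_cases (a + b) with h' | h' <;>
        rcases abs_cases (b - a) with h'' | h'' <;> linarith
    have h2 : 2 * |b| ≤ |a + b| + |b - a| := by
      rcases abs_cases b with h | h <;> rcases abs_cases (a + b) with h' | h' <;>
        rcases abs_cases (b - a) with h'' | h'' <;> linarith
    linarith [abs_nonneg (a + b), abs_nonneg (b - a)]
  have hP : 0 < P := hp.trans_le hpP
  calc p * |p - 1| * W ≤ p * |p - 1| * (2 * |a + b| + 2 * |b - a| + δ) := by gcongr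
    _ = 2 * |p - 1| * (p * |a + b|) + 2 * p * (|p - 1| * |b - a|) + p * |p - 1| * δ := by ring
    _ ≤ 2 * (P + 1) * (3 * δ) + 2 * P * (4 * δ) + P * (P + 1) * δ := by gcongr
    _ ≤ (12 + 15 * P) * (P + 1) * δ := by
      have : 0 ≤ P * δ := by positivity
      have : 0 ≤ P * (P * δ) := by positivity
      nlinarith

/-- Bounded positive Neumann eigenvalues are, quantitatively in `ε`, close to the spectrum
`{0, 2 / M}` of the limiting Steklov problem. -/
lemma exists_mul_abs_sub_one_le_of_isNeumannEV1D {M : ℝ} (hM : 0 < M) (K : ℝ) :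
    ∃ C : ℝ, ∀ ε ∈ Set.Ioo (0 : ℝ) 1, ∀ lam : ℝ, 0 < lam → lam ≤ K → IsNeumannEV1D M ε lam →
      lam * (M / 2) * |lam * (M / 2) - 1| ≤ C * ε := by
  set D : ℝ := K * (M / 2 + 1) + 2 * K with hD
  set E : ℝ := K * (1 + M / 2 * D) with hE
  refine ⟨(12 + 15 * (K * (M / 2))) * (K * (M / 2) + 1) * (E + 8 * D + 8 * K), ?_⟩
  rintro ε hε lam hlam hK ⟨u, ⟨y, hy, huy⟩, hdiff, hcont', hode, hl, hr⟩
  obtain ⟨h0, h1⟩ := id hε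
  have hK0 : 0 < K := hlam.trans_le hK
  have hcont : ContinuousOn u (Set.Icc (-1) 1) := fun x hx =>
    (hdiff x hx).continuousAt.continuousWithinAt
  obtain ⟨z, hz, hmax⟩ := isCompact_Icc.exists_isMaxOn ⟨y, hy⟩ hcont.abs
  set W : ℝ := |u z| with hW
  have hbound : ∀ x ∈ Set.Icc (-1 : ℝ) 1, |u x| ≤ W := fun x hx => hmax hx
  have hWpos : 0 < W := (abs_pos.2 huy).trans_le (hbound y hy)
  have hD0 : 0 < D := by positivity
  have hE0 : 0 < E := by positivity
  -- restrictions of the regularity hypotheses to subintervals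
  have hmono : ∀ {a b : ℝ}, -1 ≤ a → b ≤ 1 → Set.Icc a b ⊆ Set.Icc (-1) 1 :=
    fun ha hb => Set.Icc_subset_Icc ha hb
  have hlayerL : ∀ x ∈ Set.Ioo (-1 : ℝ) (-1 + ε), DifferentiableAt ℝ (deriv u) x ∧
      deriv (deriv u) x = -(lam * (M / (2 * ε) - 1 + ε) * u x) := fun x hx => by
    obtain ⟨hd, he⟩ := hode x ⟨hx.1, by linarith [hx.2]⟩ hx.2.ne (by linarith [hx.2] : x < _).ne
    rw [rho1D_of_notMem_Ioo fun h => lt_asymm h.1 hx.2] at he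
    exact ⟨hd, by linarith⟩
  have hlayerR : ∀ x ∈ Set.Ioo (1 - ε) 1, DifferentiableAt ℝ (deriv u) x ∧
      deriv (deriv u) x = -(lam * (M / (2 * ε) - 1 + ε) * u x) := fun x hx => by
    obtain ⟨hd, he⟩ := hode x ⟨by linarith [hx.1], hx.2⟩ (by linarith [hx.1] : _ < x).ne' hx.1.ne'
    rw [rho1D_of_notMem_Ioo fun h => lt_asymm h.2 hx.1] at he
    exact ⟨hd, by linarith⟩
  have hmiddle : ∀ x ∈ Set.Ioo (-1 + ε) (1 - ε), DifferentiableAt ℝ (deriv u) x ∧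
      deriv (deriv u) x = -(lam * ε * u x) := fun x hx => by
    obtain ⟨hd, he⟩ := hode x ⟨by linarith [hx.1], by linarith [hx.2]⟩ hx.1.ne' hx.2.ne
    rw [rho1D_of_mem_Ioo hx] at he
    exact ⟨hd, by linarith⟩
  -- crude bounds for the first derivative
  have hcrude : ∀ x ∈ Set.Icc (-1 : ℝ) 1, |-(lam * (M / (2 * ε) - 1 + ε) * u x)| ≤
      K * (M / (2 * ε) + 1) * W := fun x hx => by
    have hMε : 0 < M / (2 * ε) := by positivity
    rw [abs_neg, abs_mul, abs_mul, abs_of_pos hlam]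
    gcongr
    · exact abs_le.2 ⟨by linarith, by linarith⟩
    · exact hbound x hx
  have hscale : K * (M / (2 * ε) + 1) * W * ε ≤ K * (M / 2 + 1) * W := by
    have : K * (M / (2 * ε) + 1) * W * ε = K * (M / 2 + ε) * W := by field_simp
    rw [this]
    gcongr
  have hderivL : ∀ x ∈ Set.Icc (-1 : ℝ) (-1 + ε), |deriv u x| ≤ K * (M / 2 + 1) * W :=
    fun x hx => by
    have h := abs_sub_le_of_abs_deriv_le (L := K * (M / (2 * ε) + 1) * W) hx.1
      (hcont'.mono (hmono le_rfl (by linarith [hx.2])))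
      (fun w hw => (hlayerL w ⟨hw.1, hw.2.trans_le hx.2⟩).1)
      (fun w hw => by
        rw [(hlayerL w ⟨hw.1, hw.2.trans_le hx.2⟩).2]
        exact hcrude w ⟨hw.1.le, by linarith [hw.2, hx.2]⟩)
    rw [hl, sub_zero] at h
    refine (h.trans ?_).trans hscale
    gcongr
    linarith [hx.2]
  have hderivR : ∀ x ∈ Set.Icc (1 - ε) 1, |deriv u x| ≤ K * (M / 2 + 1) * W :=
    fun x hx => by
    have h := abs_sub_le_of_abs_deriv_le (L := K * (M / (2 * ε) + 1) * W) hx.2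
      (hcont'.mono (hmono (by linarith [hx.1]) le_rfl))
      (fun w hw => (hlayerR w ⟨hx.1.trans_lt hw.1, hw.2⟩).1)
      (fun w hw => by
        rw [(hlayerR w ⟨hx.1.trans_lt hw.1, hw.2⟩).2]
        exact hcrude w ⟨by linarith [hw.1, hx.1], hw.2.le⟩)
    rw [hr, zero_sub, abs_neg] at h
    refine (h.trans ?_).trans hscale
    gcongr
    linarith [hx.1]
  have hDW : K * (M / 2 + 1) * W ≤ D * W := by
    gcongr
    linarith
  -- oscillation of the function in the layers
  have hoscL : ∀ x ∈ Set.Icc (-1 : ℝ) (-1 + ε), |u x - u (-1)| ≤ D * W * ε := fun x hx => by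
    have h := abs_sub_le_of_abs_deriv_le (L := D * W) hx.1
      (hcont.mono (hmono le_rfl (by linarith [hx.2])))
      (fun w hw => hdiff w ⟨hw.1.le, by linarith [hw.2, hx.2]⟩)
      (fun w hw => (hderivL w ⟨hw.1.le, hw.2.le.trans hx.2⟩).trans hDW)
    refine h.trans ?_
    gcongr
    linarith [hx.2]
  have hoscR : ∀ x ∈ Set.Icc (1 - ε) 1, |u x - u 1| ≤ D * W * ε := fun x hx => by
    have h := abs_sub_le_of_abs_deriv_le (L := D * W) hx.2
      (hcont.mono (hmono (by linarith [hx.1]) le_rfl))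
      (fun w hw => hdiff w ⟨by linarith [hw.1, hx.1], hw.2.le⟩)
      (fun w hw => (hderivR w ⟨hx.1.trans hw.1.le, hw.2.le⟩).trans hDW)
    rw [abs_sub_comm]
    refine h.trans ?_
    gcongr
    linarith [hx.1]
  -- the boundary relations and the behaviour in the middle
  set s : ℝ := deriv u (-1 + ε) with hs
  set t : ℝ := deriv u (1 - ε) with ht
  have hleft : |s + lam * (M / 2) * u (-1)| ≤ E * W * ε := by
    have h := abs_sub_sub_mul_le_of_abs_deriv_sub_le (L := E * W)
      (k := -(lam * (M / (2 * ε)) * u (-1))) (by linarith : (-1 : ℝ) ≤ -1 + ε)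
      (hcont'.mono (hmono le_rfl (by linarith))) (fun w hw => (hlayerL w hw).1)
      (fun w hw => by
        rw [(hlayerL w hw).2]
        exact abs_boundary_layer_source_le hM hε hlam hK
          (hbound w ⟨hw.1.le, by linarith [hw.2]⟩) (hoscL w ⟨hw.1.le, hw.2.le⟩))
    rw [hl] at h
    convert h using 2
    · field_simp
      ring
    · ring
  have hright : |t - lam * (M / 2) * u 1| ≤ E * W * ε := by
    have h := abs_sub_sub_mul_le_of_abs_deriv_sub_le (L := E * W)
      (k := -(lam * (M / (2 * ε)) * u 1)) (by linarith : 1 - ε ≤ 1)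
      (hcont'.mono (hmono (by linarith) le_rfl)) (fun w hw => (hlayerR w hw).1)
      (fun w hw => by
        rw [(hlayerR w hw).2]
        exact abs_boundary_layer_source_le hM hε hlam hK
          (hbound w ⟨by linarith [hw.1], hw.2.le⟩) (hoscR w ⟨hw.1.le, hw.2.le⟩))
    rw [hr, ← abs_neg] at h
    convert h using 2
    · field_simp
      ring
    · ring
  have hslope : ∀ x ∈ Set.Icc (-1 + ε) (1 - ε), |deriv u x - s| ≤ 2 * K * W * ε := fun x hx => by
    have h := abs_sub_le_of_abs_deriv_le (L := K * ε * W) hx.1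
      (hcont'.mono (hmono (by linarith) (by linarith [hx.2])))
      (fun w hw => (hmiddle w ⟨hw.1, hw.2.trans_le hx.2⟩).1)
      (fun w hw => by
        rw [(hmiddle w ⟨hw.1, hw.2.trans_le hx.2⟩).2, abs_neg, abs_mul,
          abs_of_pos (mul_pos hlam h0)]
        gcongr
        exact hbound w ⟨by linarith [hw.1], by linarith [hw.2, hx.2]⟩)
    calc |deriv u x - s| ≤ K * ε * W * (x - (-1 + ε)) := h
      _ ≤ K * ε * W * 2 := by gcongr; linarith [hx.2]
      _ = 2 * K * W * ε := by ring
  have haffine : ∀ x ∈ Set.Icc (-1 + ε) (1 - ε),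
      |u x - u (-1 + ε) - s * (x - (-1 + ε))| ≤ 4 * K * W * ε := fun x hx => by
    have h := abs_sub_sub_mul_le_of_abs_deriv_sub_le (L := 2 * K * W * ε) (k := s) hx.1
      (hcont.mono (hmono (by linarith) (by linarith [hx.2])))
      (fun w hw => hdiff w ⟨by linarith [hw.1], by linarith [hw.2, hx.2]⟩)
      (fun w hw => hslope w ⟨hw.1.le, hw.2.le.trans hx.2⟩)
    calc _ ≤ 2 * K * W * ε * (x - (-1 + ε)) := h
      _ ≤ 2 * K * W * ε * 2 := by gcongr; linarith [hx.2]
      _ = 4 * K * W * ε := by ring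
  have hsD : |s * ε| ≤ D * W * ε := by
    rw [abs_mul, abs_of_pos h0]
    gcongr
    exact (hderivL _ ⟨by linarith, le_rfl⟩).trans hDW
  have hKW : 0 < K * W * ε := by positivity
  have hDWε : 0 < D * W * ε := by positivity
  have hEW : 0 < E * W * ε := by positivity
  have hl_osc := hoscL (-1 + ε) ⟨by linarith, le_rfl⟩
  have hr_osc := hoscR (1 - ε) ⟨le_rfl, by linarith⟩
  have hjump : |u 1 - u (-1) - 2 * s| ≤ 4 * (D * W * ε) + 4 * (K * W * ε) := by
    have h := haffine (1 - ε) ⟨by linarith, le_rfl⟩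
    rw [abs_le] at h hsD hl_osc hr_osc ⊢
    constructor <;> linarith
  have hsize : W ≤ 2 * |u (-1)| + |u 1| + 8 * (D * W * ε + K * W * ε) := by
    have ha0 := abs_nonneg (u (-1))
    have hb0 := abs_nonneg (u 1)
    rcases le_total z (-1 + ε) with hzL | hzL
    · have h := hoscL z ⟨hz.1, hzL⟩
      have := abs_sub_abs_le_abs_sub (u z) (u (-1))
      linarith
    rcases le_total z (1 - ε) with hzR | hzR
    · have h := haffine z ⟨hzL, hzR⟩
      have hsz : |s * (z - (-1 + ε))| ≤ 2 * |s| := by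
        rw [abs_mul, abs_of_nonneg (by linarith : 0 ≤ z - (-1 + ε)), mul_comm]
        gcongr
        linarith
      have h2s : 2 * |s| ≤ |u 1| + |u (-1)| + (4 * (D * W * ε) + 4 * (K * W * ε)) := by
        have h3 := abs_sub (u 1) (u (-1))
        have h4 := abs_sub_abs_le_abs_sub (2 * s) (u 1 - u (-1))
        rw [abs_sub_comm (2 * s), abs_mul, abs_two] at h4
        linarith
      have h5 := abs_sub_abs_le_abs_sub (u (-1 + ε)) (u (-1))
      have h6 := abs_sub_abs_le_abs_sub (u z - u (-1 + ε)) (s * (z - (-1 + ε)))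
      have h7 := abs_sub_abs_le_abs_sub (u z) (u (-1 + ε))
      linarith
    · have h := hoscR z ⟨hzR, hz.2⟩
      have := abs_sub_abs_le_abs_sub (u z) (u 1)
      linarith
  have hδ : (E + 8 * D + 8 * K) * W * ε =
      E * W * ε + 8 * (D * W * ε) + 8 * (K * W * ε) := by ring
  have key := mul_abs_sub_one_mul_le (δ := (E + 8 * D + 8 * K) * W * ε) (p := lam * (M / 2))
    (P := K * (M / 2)) (by positivity) (by gcongr) (hleft.trans (by linarith))
    (hright.trans (by linarith)) ((hslope (1 - ε) ⟨by linarith, le_rfl⟩).trans (by linarith))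
    (hjump.trans (by linarith)) (hsize.trans (by linarith))
  refine le_of_mul_le_mul_right (key.trans_eq ?_) hWpos
  ring

/-- Along any sequence `ε_n → 0`, a convergent sequence of positive Neumann eigenvalues can
only converge to `0` or `2/M`; in particular a sequence of positive eigenvalues staying
uniformly away from `0` and `2/M` diverges to `+∞`. -/
theorem neumann_1d_limit_points
    (M : ℝ) (hM : 0 < M) (ε lam : ℕ → ℝ)
    (hε : ∀ n, ε n ∈ Set.Ioo (0:ℝ) 1)
    (hε0 : Filter.Tendsto ε Filter.atTop (nhds 0))
    (hlam : ∀ n, 0 < lam n ∧ IsNeumannEV1D M (ε n) (lam n)) :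
    (∀ lbar : ℝ, Filter.Tendsto lam Filter.atTop (nhds lbar) →
      lbar = 0 ∨ lbar = 2 / M) ∧
    ((∃ c > (0:ℝ), ∀ n, c ≤ |lam n| ∧ c ≤ |lam n - 2 / M|) →
      Filter.Tendsto lam Filter.atTop Filter.atTop) := by
  have hp : ∀ x : ℝ, x * (M / 2) - 1 = (x - 2 / M) * (M / 2) := fun x => by field_simp
  refine ⟨fun lbar hlim => ?_, ?_⟩
  · obtain ⟨K, hK⟩ := hlim.bddAbove_range
    obtain ⟨C, hC⟩ := exists_mul_abs_sub_one_le_of_isNeumannEV1D hM K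
    have hle : ∀ n, lam n * (M / 2) * |lam n * (M / 2) - 1| ≤ C * ε n := fun n =>
      hC (ε n) (hε n) (lam n) (hlam n).1 (hK ⟨n, rfl⟩) (hlam n).2
    have hzero : Filter.Tendsto (fun n => C * ε n) Filter.atTop (nhds 0) := by
      simpa using hε0.const_mul C
    have hp_lim := hlim.mul_const (M / 2)
    have h := le_of_tendsto_of_tendsto' (hp_lim.mul (hp_lim.sub_const 1).abs) hzero hle
    have hbar : 0 ≤ lbar := ge_of_tendsto' hlim fun n => (hlam n).1.le
    have heq := le_antisymm h (by positivity)
    rcases mul_eq_zero.1 heq with h' | h'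
    · exact Or.inl ((mul_eq_zero.1 h').resolve_right (by positivity))
    · rw [abs_eq_zero, hp] at h'
      exact Or.inr (sub_eq_zero.1 ((mul_eq_zero.1 h').resolve_right (by positivity)))
  · rintro ⟨c, hc, hsep⟩
    refine Filter.tendsto_atTop.2 fun K => ?_
    obtain ⟨C, hC⟩ := exists_mul_abs_sub_one_le_of_isNeumannEV1D hM K
    have hzero : Filter.Tendsto (fun n => C * ε n) Filter.atTop (nhds 0) := by
      simpa using hε0.const_mul C
    have hpos : 0 < c * (M / 2) * (c * (M / 2)) := by positivity
    filter_upwards [hzero.eventually_lt_const hpos] with n hn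
    by_contra! hlt
    have h := hC (ε n) (hε n) (lam n) (hlam n).1 hlt.le (hlam n).2
    have hfar := (hsep n).1
    rw [abs_of_pos (hlam n).1] at hfar
    rw [hp, abs_mul, abs_of_pos (by positivity : 0 < M / 2)] at h
    refine (h.trans_lt hn).not_ge ?_
    have hlam_pos := (hlam n).1
    gcongr
    exact (hsep n).2
end
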